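/- Let n ≥ 1, let (a,b) ⊆ ℝ be an open interval, let B0, B1 : (a,b) → ℂ^{2n×2n} be such that B0(x) and B1(x) are Hermitian for every x ∈ (a,b), fix c ∈ (a,b) and λ ∈ ℂ with Im λ ≠ 0, and suppose Φ_λ, Φ_λ̄ : (a,b) → ℂ^{2n×2n} are differentiable solutions of J Φ_λ' = (B0(x) + λ B1(x)) Φ_λ and J Φ_λ̄' = (B0(x) + λ̄ B1(x)) Φ_λ̄ with Φ_λ(c) = Φ_λ̄(c) = I_{2n}. Define A(x;λ) := (1/(2 Im λ)) Φ_λ(x)* (J/i) Φ_λ(x) and A(x;λ̄) := (1/(2 Im λ̄)) Φ_λ̄(x)* (J/i) Φ_λ̄(x). Then for every x ∈ (a,b), the matrix A(x;λ) is invertible and A(x;λ̄) = -(1/(2 Im λ)²) (J/i) A(x;λ)^{-1} (J/i). -/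

import Mathlib

open Matrix Set

noncomputable section

/-- The standard `2n × 2n` complex symplectic matrix `J = [[0, -I],[I, 0]]`. -/
def stdJ (n : ℕ) : Matrix (Fin n ⊕ Fin n) (Fin n ⊕ Fin n) ℂ :=
  Matrix.fromBlocks 0 (-1) 1 0

/-- The Hermitian matrix `J/i = -iJ`. -/
def stdJi (n : ℕ) : Matrix (Fin n ⊕ Fin n) (Fin n ⊕ Fin n) ℂ :=
  (-Complex.I) • stdJ n

/-- Niessen's matrix `A(x;λ) = (1/(2 Im λ)) Φ(x)* (J/i) Φ(x)`. -/
def calA (n : ℕ) (lam : ℂ) (Φ : ℝ → Matrix (Fin n ⊕ Fin n) (Fin n ⊕ Fin n) ℂ)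
    (x : ℝ) : Matrix (Fin n ⊕ Fin n) (Fin n ⊕ Fin n) ℂ :=
  (1 / (2 * (lam.im : ℂ))) • ((Φ x)ᴴ * stdJi n * Φ x)

theorem stdJ_conjTranspose (n : ℕ) : (stdJ n)ᴴ = -stdJ n := by
  simp [stdJ, fromBlocks_conjTranspose, fromBlocks_neg]

theorem stdJi_conjTranspose (n : ℕ) : (stdJi n)ᴴ = stdJi n := by
  simp [stdJi, conjTranspose_smul, stdJ_conjTranspose]

theorem stdJi_mul_self (n : ℕ) : stdJi n * stdJi n = 1 := by
  simp [stdJi, stdJ, fromBlocks_multiply, smul_smul, fromBlocks_smul, ← fromBlocks_one]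

/-- The product rule for matrix-valued functions differentiable entrywise. -/
theorem hasDerivAt_matrix_mul_apply {l m p : Type*} [Fintype m]
    {P : ℝ → Matrix l m ℂ} {Q : ℝ → Matrix m p ℂ} {P' : Matrix l m ℂ} {Q' : Matrix m p ℂ} {x : ℝ}
    (hP : ∀ i j, HasDerivAt (fun t => P t i j) (P' i j) x)
    (hQ : ∀ i j, HasDerivAt (fun t => Q t i j) (Q' i j) x) (i : l) (j : p) :
    HasDerivAt (fun t => (P t * Q t) i j) ((P' * Q x + P x * Q') i j) x := by
  simp only [Matrix.add_apply, Matrix.mul_apply, ← Finset.sum_add_distrib]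
  exact HasDerivAt.fun_sum fun k _ => (hP i k).mul (hQ k j)

/-- The Lagrange identity: if `J U' = M U` and `J V' = Mᴴ V` on an interval, then `Vᴴ J U`
is constant there. -/
theorem conjTranspose_mul_stdJ_mul_eq {n : ℕ} {a b : ℝ}
    {M U V DU DV : ℝ → Matrix (Fin n ⊕ Fin n) (Fin n ⊕ Fin n) ℂ}
    (hU : ∀ x ∈ Ioo a b, ∀ i j, HasDerivAt (fun t => U t i j) (DU x i j) x)
    (hV : ∀ x ∈ Ioo a b, ∀ i j, HasDerivAt (fun t => V t i j) (DV x i j) x)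
    (hODEU : ∀ x ∈ Ioo a b, stdJ n * DU x = M x * U x)
    (hODEV : ∀ x ∈ Ioo a b, stdJ n * DV x = (M x)ᴴ * V x)
    {x y : ℝ} (hx : x ∈ Ioo a b) (hy : y ∈ Ioo a b) :
    (V x)ᴴ * (stdJ n * U x) = (V y)ᴴ * (stdJ n * U y) := by
  have hderiv : ∀ t ∈ Ioo a b, ∀ i j,
      HasDerivAt (fun s => ((V s)ᴴ * (stdJ n * U s)) i j) 0 t := by
    intro t ht i j
    have hJU := hasDerivAt_matrix_mul_apply (P := fun _ => stdJ n) (P' := 0)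
      (fun i j => hasDerivAt_const t (stdJ n i j)) (hU t ht)
    have hVH : ∀ i j, HasDerivAt (fun s => (V s)ᴴ i j) ((DV t)ᴴ i j) t :=
      fun i j => (hV t ht j i).star
    have hmul := hasDerivAt_matrix_mul_apply hVH hJU i j
    have hadj : (DV t)ᴴ * stdJ n = -((V t)ᴴ * M t) := by
      have h := congrArg conjTranspose (hODEV t ht)
      rw [conjTranspose_mul, conjTranspose_mul, conjTranspose_conjTranspose,
        stdJ_conjTranspose, Matrix.mul_neg] at h
      rw [← h, neg_neg]
    have hzero : (DV t)ᴴ * (stdJ n * U t) + (V t)ᴴ * (0 * U t + stdJ n * DU t) = 0 := by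
      rw [Matrix.zero_mul, zero_add, hODEU t ht, ← Matrix.mul_assoc, hadj, Matrix.neg_mul,
        Matrix.mul_assoc, neg_add_cancel]
    rw [hzero] at hmul
    exact hmul
  ext i j
  exact isOpen_Ioo.is_const_of_deriv_eq_zero isPreconnected_Ioo
    (fun t ht => (hderiv t ht i j).differentiableAt.differentiableWithinAt)
    (fun t ht => (hderiv t ht i j).deriv) hx hy

/-- For the fundamental solutions `Φ_λ` and `Φ_λ̄` normalized at `c`, the matrix `A(x;λ)` is
invertible and `A(x;λ̄) = -(1/(2 Im λ)²) (J/i) A(x;λ)⁻¹ (J/i)` for all `x ∈ (a,b)`. -/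
theorem calA_conj_eq_neg_inv
    (n : ℕ) (hn : 1 ≤ n) (a b : ℝ) (hab : a < b)
    (B0 B1 : ℝ → Matrix (Fin n ⊕ Fin n) (Fin n ⊕ Fin n) ℂ)
    (hB0 : ∀ x ∈ Ioo a b, (B0 x).IsHermitian)
    (hB1 : ∀ x ∈ Ioo a b, (B1 x).IsHermitian)
    (c : ℝ) (hc : c ∈ Ioo a b) (lam : ℂ) (hlam : lam.im ≠ 0)
    (Φ Φb DΦ DΦb : ℝ → Matrix (Fin n ⊕ Fin n) (Fin n ⊕ Fin n) ℂ)
    (hΦ : ∀ x ∈ Ioo a b, ∀ i j, HasDerivAt (fun t => Φ t i j) (DΦ x i j) x)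
    (hΦb : ∀ x ∈ Ioo a b, ∀ i j, HasDerivAt (fun t => Φb t i j) (DΦb x i j) x)
    (hODE : ∀ x ∈ Ioo a b, stdJ n * DΦ x = (B0 x + lam • B1 x) * Φ x)
    (hODEb : ∀ x ∈ Ioo a b,
      stdJ n * DΦb x = (B0 x + (starRingEnd ℂ lam) • B1 x) * Φb x)
    (hΦc : Φ c = 1) (hΦbc : Φb c = 1) :
    ∀ x ∈ Ioo a b,
      IsUnit (calA n lam Φ x) ∧
      calA n (starRingEnd ℂ lam) Φb x =
        -(((1 / (2 * lam.im) ^ 2 : ℝ) : ℂ)) • (stdJi n * (calA n lam Φ x)⁻¹ * stdJi n) := by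
  intro x hx
  have hconst := conjTranspose_mul_stdJ_mul_eq hΦ hΦb hODE (fun t ht => by
    rw [hODEb t ht, conjTranspose_add, conjTranspose_smul, (hB0 t ht).eq, (hB1 t ht).eq,
      starRingEnd_apply]) hx hc
  rw [hΦc, hΦbc, conjTranspose_one, Matrix.one_mul, Matrix.mul_one] at hconst
  have hK : (Φb x)ᴴ * (stdJi n * Φ x) = stdJi n := by
    rw [stdJi, Matrix.smul_mul, Matrix.mul_smul, hconst]
  have hK' : (Φ x)ᴴ * stdJi n * Φb x = stdJi n := by
    simpa [conjTranspose_mul, stdJi_conjTranspose] using congrArg conjTranspose hK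
  have hKK := stdJi_mul_self n
  have hright : Φ x * (stdJi n * (Φb x)ᴴ * stdJi n) = 1 := by
    rw [mul_eq_one_comm, Matrix.mul_assoc, Matrix.mul_assoc, hK, hKK]
  have hprod : ((Φ x)ᴴ * stdJi n * Φ x) *
      (stdJi n * ((Φb x)ᴴ * stdJi n * Φb x) * stdJi n) = 1 :=
    calc _ = (Φ x)ᴴ * stdJi n * (Φ x * (stdJi n * (Φb x)ᴴ * stdJi n)) * Φb x * stdJi n := by
          simp only [Matrix.mul_assoc]
      _ = 1 := by rw [hright, Matrix.mul_one, hK', hKK]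
  have him : (lam.im : ℂ) ≠ 0 := by exact_mod_cast hlam
  have hinv : calA n lam Φ x * ((2 * (lam.im : ℂ)) •
      (stdJi n * ((Φb x)ᴴ * stdJi n * Φb x) * stdJi n)) = 1 := by
    rw [calA, smul_mul_smul_comm, hprod, one_div_mul_cancel (by simpa using him), one_smul]
  refine ⟨IsUnit.of_mul_eq_one _ hinv, ?_⟩
  rw [Matrix.inv_eq_right_inv hinv, Matrix.mul_smul, Matrix.smul_mul, smul_smul, calA]
  have hcancel (X : Matrix (Fin n ⊕ Fin n) (Fin n ⊕ Fin n) ℂ) :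
      stdJi n * (stdJi n * X * stdJi n) * stdJi n = X := by
    rw [← Matrix.mul_assoc, ← Matrix.mul_assoc, hKK, Matrix.one_mul, Matrix.mul_assoc, hKK,
      Matrix.mul_one]
  rw [hcancel]
  congr 1
  push_cast [Complex.conj_im]
  field_simp
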